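/- Let K ⊆ ℝ² be a convex body contained in the closed upper half-plane {(u,v) : v ≥ 0}, with the origin 0 on the boundary of K, and suppose K is symmetric with respect to the vertical axis (i.e., (u,v) ∈ K if and only if (−u,v) ∈ K). Let K̄ ⊆ ℝ² be the Blaschke shaking of K with respect to the horizontal axis, namely K̄ = {(u,w) : the vertical section {v : (u,v) ∈ K} is nonempty and 0 ≤ w ≤ len(u)}, where len(u) is the 1-dimensional Lebesgue measure of {v : (u,v) ∈ K}. If X_1, X_2 are independent uniformly random points in K and X̄_1, X̄_2 are independent uniformly random points in K̄, then E(area(conv{0, X_1, X_2})) ≥ E(area(conv{0, X̄_1, X̄_2})). -/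

import Mathlib

open MeasureTheory

/-- A convex body in `ℝ²`: a compact convex set with nonempty interior. -/
def IsConvexBody (K : Set (ℝ × ℝ)) : Prop :=
  IsCompact K ∧ Convex ℝ K ∧ (interior K).Nonempty

/-- The area of a triangle with a vertex at the origin is proportional to the absolute value of
the determinant of the other two vertices. -/
lemma exists_volume_convexHull_origin_pair_eq : ∃ c : ℝ, 0 ≤ c ∧ ∀ x y : ℝ × ℝ,
    (volume (convexHull ℝ {(0, 0), x, y})).toReal = |x.1 * y.2 - y.1 * x.2| * c := by
  refine ⟨(volume (convexHull ℝ {((0, 0) : ℝ × ℝ), (1, 0), (0, 1)})).toReal,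
    ENNReal.toReal_nonneg, fun x y => ?_⟩
  set L : (ℝ × ℝ) →ₗ[ℝ] ℝ × ℝ :=
    Matrix.toLin (Module.Basis.finTwoProd ℝ) (Module.Basis.finTwoProd ℝ) !![x.1, y.1; x.2, y.2]
    with hL
  have himage : convexHull ℝ {(0, 0), x, y} =
      L '' convexHull ℝ {((0, 0) : ℝ × ℝ), (1, 0), (0, 1)} := by
    rw [LinearMap.image_convexHull]
    simp [Set.image_insert_eq, hL, Matrix.toLin_finTwoProd_apply]
  have hdet : LinearMap.det L = x.1 * y.2 - y.1 * x.2 := by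
    rw [hL, LinearMap.det_toLin, Matrix.det_fin_two_of]
  rw [himage, Measure.addHaar_image_linearMap, hdet, ENNReal.toReal_mul,
    ENNReal.toReal_ofReal (abs_nonneg _)]

lemma abs_sub_add_abs_add_le_of_abs_le {a b c d : ℝ} (hab : |a| ≤ |c|) (hbd : |b| ≤ |d|) :
    |a - b| + |a + b| ≤ |c - d| + |c + d| := by
  have key : ∀ x y : ℝ, |x - y| + |x + y| = 2 * max |x| |y| := by
    intro x y
    rcases abs_cases x with h | h <;> rcases abs_cases y with h' | h' <;>
      rcases abs_cases (x - y) with h1 | h1 <;> rcases abs_cases (x + y) with h2 | h2 <;>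
      rcases max_cases |x| |y| with h3 | h3 <;> linarith
  rw [key, key]
  gcongr

lemma IsCompact.vertical_section {K : Set (ℝ × ℝ)} (hK : IsCompact K) (u : ℝ) :
    IsCompact {v : ℝ | (u, v) ∈ K} :=
  (Topology.IsClosedEmbedding.of_continuous_injective_isClosedMap (by fun_prop)
    (Prod.mk_right_injective u) (isClosedMap_prodMk_left u)).isCompact_preimage hK

/-- The lower boundary function of a compact planar set is measurable. -/
lemma IsCompact.measurable_sInf_section {K : Set (ℝ × ℝ)} (hK : IsCompact K) :
    Measurable fun u : ℝ => sInf {v : ℝ | (u, v) ∈ K} := by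
  have hsec := hK.vertical_section
  refine measurable_of_Iic fun c => ?_
  have h1 : MeasurableSet (Prod.fst '' K) := (hK.image continuous_fst).measurableSet
  have h2 : MeasurableSet (Prod.fst '' (K ∩ {p | p.2 ≤ c})) :=
    ((hK.inter_right (isClosed_le continuous_snd continuous_const)).image
      continuous_fst).measurableSet
  have heq : (fun u : ℝ => sInf {v : ℝ | (u, v) ∈ K}) ⁻¹' Set.Iic c =
      Prod.fst '' (K ∩ {p | p.2 ≤ c}) ∪ ((Prod.fst '' K)ᶜ ∩ {_u | 0 ≤ c}) := by
    ext u
    rcases Set.eq_empty_or_nonempty {v : ℝ | (u, v) ∈ K} with he | hne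
    · have hn : ∀ v, (u, v) ∉ K := fun v hv => (he.subset hv : v ∈ (∅ : Set ℝ))
      simp [hn]
    · have hmem := (hsec u).sInf_mem hne
      constructor
      · intro h
        exact Or.inl ⟨(u, _), ⟨hmem, h⟩, rfl⟩
      · rintro (⟨⟨u', v⟩, ⟨hv, hc⟩, rfl⟩ | ⟨h, -⟩)
        · exact (csInf_le (hsec _).bddBelow hv).trans hc
        · exact absurd ⟨(u, _), hmem, rfl⟩ h
  rw [heq]
  exact h2.union (h1.compl.inter (MeasurableSet.const _))

/-- The vertical shear translating the fibre over `u` by `-a u`. -/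
def verticalShear (a : ℝ → ℝ) (ha : Measurable a) : (ℝ × ℝ) ≃ᵐ (ℝ × ℝ) where
  toFun p := (p.1, p.2 - a p.1)
  invFun p := (p.1, p.2 + a p.1)
  left_inv p := by simp
  right_inv p := by simp
  measurable_toFun := by
    change Measurable fun p : ℝ × ℝ => (p.1, p.2 - a p.1)
    fun_prop
  measurable_invFun := by
    change Measurable fun p : ℝ × ℝ => (p.1, p.2 + a p.1)
    fun_prop

lemma measurePreserving_verticalShear (a : ℝ → ℝ) (ha : Measurable a) :
    MeasurePreserving (verticalShear a ha) :=
  (MeasurePreserving.id volume).skew_product (g := fun u v => v - a u)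
    (by unfold Function.uncurry; fun_prop)
    (Filter.Eventually.of_forall fun u => (measurePreserving_sub_right volume (a u)).map_eq)

/-- Integrals over `K ×ˢ K` may be symmetrized in the first point when `K` is symmetric about the
vertical axis. -/
lemma setIntegral_prod_reflect {K : Set (ℝ × ℝ)}
    (hsym : ∀ u v : ℝ, (u, v) ∈ K ↔ (-u, v) ∈ K) (F : (ℝ × ℝ) × (ℝ × ℝ) → ℝ) :
    ∫ q in K ×ˢ K, F ((-q.1.1, q.1.2), q.2) = ∫ q in K ×ˢ K, F q := by
  let R : ((ℝ × ℝ) × (ℝ × ℝ)) ≃ᵐ ((ℝ × ℝ) × (ℝ × ℝ)) :=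
    ((MeasurableEquiv.neg ℝ).prodCongr (.refl ℝ)).prodCongr (.refl (ℝ × ℝ))
  have hR : MeasurePreserving R :=
    ((Measure.measurePreserving_neg volume).prod (.id volume)).prod (.id volume)
  have hpre : R ⁻¹' (K ×ˢ K) = K ×ˢ K := by
    ext ⟨⟨u, v⟩, p⟩
    exact and_congr_left' (hsym u v).symm
  have h := hR.setIntegral_preimage_emb R.measurableEmbedding F (K ×ˢ K)
  rw [hpre] at h
  exact h

/-- Decreasing nonnegative second coordinates by a measurable amount that is even in the first
coordinate decreases the integral of the absolute determinant over a symmetric set. -/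
lemma setIntegral_abs_det_shear_le {K : Set (ℝ × ℝ)} (hK : IsCompact K)
    (hsym : ∀ u v : ℝ, (u, v) ∈ K ↔ (-u, v) ∈ K) {a : ℝ → ℝ} (ha : Measurable a)
    (heven : ∀ u, a (-u) = a u) (ha_nonneg : ∀ p ∈ K, 0 ≤ a p.1) (ha_le : ∀ p ∈ K, a p.1 ≤ p.2) :
    ∫ q in K ×ˢ K, |q.1.1 * (q.2.2 - a q.2.1) - q.2.1 * (q.1.2 - a q.1.1)| ≤
      ∫ q in K ×ˢ K, |q.1.1 * q.2.2 - q.2.1 * q.1.2| := by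
  have hKK : IsCompact (K ×ˢ K) := hK.prod hK
  have hlt : ∀ p ∈ K, |p.2 - a p.1| ≤ |p.2| := fun p hp => by
    rw [abs_of_nonneg (by linarith [ha_le p hp]),
      abs_of_nonneg (by linarith [ha_le p hp, ha_nonneg p hp])]
    linarith [ha_nonneg p hp]
  have hpt : ∀ q ∈ K ×ˢ K,
      |q.1.1 * (q.2.2 - a q.2.1)| ≤ |q.1.1 * q.2.2| ∧
        |q.2.1 * (q.1.2 - a q.1.1)| ≤ |q.2.1 * q.1.2| := by
    rintro q ⟨h1, h2⟩
    simp only [abs_mul]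
    exact ⟨mul_le_mul_of_nonneg_left (hlt _ h2) (abs_nonneg _),
      mul_le_mul_of_nonneg_left (hlt _ h1) (abs_nonneg _)⟩
  let F : (ℝ × ℝ) × (ℝ × ℝ) → ℝ := fun q => |q.1.1 * q.2.2 - q.2.1 * q.1.2|
  let F' : (ℝ × ℝ) × (ℝ × ℝ) → ℝ := fun q => |q.1.1 * q.2.2 + q.2.1 * q.1.2|
  let G : (ℝ × ℝ) × (ℝ × ℝ) → ℝ :=
    fun q => |q.1.1 * (q.2.2 - a q.2.1) - q.2.1 * (q.1.2 - a q.1.1)|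
  let G' : (ℝ × ℝ) × (ℝ × ℝ) → ℝ :=
    fun q => |q.1.1 * (q.2.2 - a q.2.1) + q.2.1 * (q.1.2 - a q.1.1)|
  have hF : IntegrableOn F (K ×ˢ K) :=
    ContinuousOn.integrableOn_compact hKK (by fun_prop)
  have hF' : IntegrableOn F' (K ×ˢ K) :=
    ContinuousOn.integrableOn_compact hKK (by fun_prop)
  have hD : IntegrableOn (fun q : (ℝ × ℝ) × (ℝ × ℝ) => |q.1.1 * q.2.2| + |q.2.1 * q.1.2|)
      (K ×ˢ K) :=
    ContinuousOn.integrableOn_compact hKK (by fun_prop)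
  have hG : IntegrableOn G (K ×ˢ K) := by
    refine hD.mono' (by fun_prop) ?_
    refine (ae_restrict_iff' hKK.measurableSet).2 (.of_forall fun q hq => ?_)
    simp only [G, Real.norm_eq_abs, abs_abs]
    exact (abs_sub _ _).trans (add_le_add (hpt q hq).1 (hpt q hq).2)
  have hG' : IntegrableOn G' (K ×ˢ K) := by
    refine hD.mono' (by fun_prop) ?_
    refine (ae_restrict_iff' hKK.measurableSet).2 (.of_forall fun q hq => ?_)
    simp only [G', Real.norm_eq_abs, abs_abs]
    exact (abs_add_le _ _).trans (add_le_add (hpt q hq).1 (hpt q hq).2)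
  have hFF' : ∫ q in K ×ˢ K, F' q = ∫ q in K ×ˢ K, F q := by
    rw [← setIntegral_prod_reflect hsym F]
    congr 1 with q
    simp only [F, F']
    rw [← abs_neg]
    ring_nf
  have hGG' : ∫ q in K ×ˢ K, G' q = ∫ q in K ×ˢ K, G q := by
    rw [← setIntegral_prod_reflect hsym G]
    congr 1 with q
    simp only [G, G', heven]
    rw [← abs_neg]
    ring_nf
  have hsum : ∫ q in K ×ˢ K, (G q + G' q) ≤ ∫ q in K ×ˢ K, (F q + F' q) :=
    setIntegral_mono_on (hG.add hG') (hF.add hF') hKK.measurableSet fun q hq =>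
      abs_sub_add_abs_add_le_of_abs_le (hpt q hq).1 (hpt q hq).2
  rw [integral_add hG hG', integral_add hF hF', hFF', hGG'] at hsum
  linarith

/-- Blaschke's shaking of a planar convex body, lying in the closed upper
half-plane with the origin on its boundary and symmetric about the vertical
axis, can only decrease the expected area of the triangle spanned by the origin
and two independent uniformly random points. -/
theorem blaschke_shaking_decreases_expected_triangle_area
    (K : Set (ℝ × ℝ)) (hK : IsConvexBody K)
    (hupper : K ⊆ {p : ℝ × ℝ | 0 ≤ p.2})
    (h0 : (0, 0) ∈ frontier K)
    (hsym : ∀ u v : ℝ, (u, v) ∈ K ↔ (-u, v) ∈ K)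
    (Kbar : Set (ℝ × ℝ))
    (hKbar : Kbar = {p : ℝ × ℝ |
        {v : ℝ | (p.1, v) ∈ K}.Nonempty ∧ 0 ≤ p.2 ∧
        p.2 ≤ (volume {v : ℝ | (p.1, v) ∈ K}).toReal}) :
    (⨍ q : (ℝ × ℝ) × (ℝ × ℝ) in K ×ˢ K,
        (volume (convexHull ℝ {(0, 0), q.1, q.2})).toReal) ≥
      ⨍ q : (ℝ × ℝ) × (ℝ × ℝ) in Kbar ×ˢ Kbar,
        (volume (convexHull ℝ {(0, 0), q.1, q.2})).toReal := by
  obtain ⟨hcomp, hconv, -⟩ := hK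
  set a : ℝ → ℝ := fun u => sInf {v : ℝ | (u, v) ∈ K} with ha_def
  have ha : Measurable a := hcomp.measurable_sInf_section
  have hsec := hcomp.vertical_section
  have hIcc (u : ℝ) (hne : {v : ℝ | (u, v) ∈ K}.Nonempty) :
      {v : ℝ | (u, v) ∈ K} = Set.Icc (a u) (sSup {v : ℝ | (u, v) ∈ K}) := by
    refine eq_Icc_of_connected_compact ⟨hne, Convex.isPreconnected ?_⟩ (hsec u)
    intro v hv w hw s t hs ht hst
    have h := hconv hv hw hs ht hst
    rw [Prod.smul_mk, Prod.smul_mk, Prod.mk_add_mk, ← add_smul, hst, one_smul] at h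
    exact h
  have ha_le (p : ℝ × ℝ) (hp : p ∈ K) : a p.1 ≤ p.2 := csInf_le (hsec p.1).bddBelow hp
  have ha_nonneg (p : ℝ × ℝ) (hp : p ∈ K) : 0 ≤ a p.1 :=
    le_csInf ⟨p.2, hp⟩ fun v hv => hupper hv
  have heven (u : ℝ) : a (-u) = a u := by simp only [ha_def, ← hsym]
  let T := verticalShear a ha
  have hpre : T ⁻¹' Kbar = K := by
    ext ⟨u, v⟩
    rw [hKbar]
    change ({v : ℝ | (u, v) ∈ K}.Nonempty ∧ 0 ≤ v - a u ∧
      v - a u ≤ (volume {v : ℝ | (u, v) ∈ K}).toReal) ↔ v ∈ {v : ℝ | (u, v) ∈ K}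
    rcases Set.eq_empty_or_nonempty {v : ℝ | (u, v) ∈ K} with he | hne
    · simp [he]
    · have hle : a u ≤ sSup {v : ℝ | (u, v) ∈ K} :=
        csInf_le_csSup hne (hsec u).bddBelow (hsec u).bddAbove
      have hvol : (volume {v : ℝ | (u, v) ∈ K}).toReal = sSup {v : ℝ | (u, v) ∈ K} - a u := by
        conv_lhs => rw [hIcc u hne]
        rw [Real.volume_Icc, ENNReal.toReal_ofReal (by linarith)]
      have hmem : v ∈ {v : ℝ | (u, v) ∈ K} ↔ a u ≤ v ∧ v ≤ sSup {v : ℝ | (u, v) ∈ K} :=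
        Set.ext_iff.1 (hIcc u hne) v
      rw [hmem, hvol]
      simp only [hne, true_and, sub_nonneg, sub_le_sub_iff_right]
  let TT := T.prodCongr T
  have hTT : MeasurePreserving TT :=
    (measurePreserving_verticalShear a ha).prod (measurePreserving_verticalShear a ha)
  have hpre2 : TT ⁻¹' (Kbar ×ˢ Kbar) = K ×ˢ K := by
    change (T ⁻¹' Kbar) ×ˢ (T ⁻¹' Kbar) = K ×ˢ K
    rw [hpre]
  have hvol : volume.real (Kbar ×ˢ Kbar) = volume.real (K ×ˢ K) := by
    rw [Measure.real, Measure.real, ← hpre2, hTT.measure_preimage_equiv]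
  have hint := hTT.setIntegral_preimage_emb TT.measurableEmbedding
    (fun q => |q.1.1 * q.2.2 - q.2.1 * q.1.2|) (Kbar ×ˢ Kbar)
  rw [hpre2] at hint
  obtain ⟨c, hc, harea⟩ := exists_volume_convexHull_origin_pair_eq
  simp only [harea]
  rw [setAverage_eq, setAverage_eq, hvol, integral_mul_const, integral_mul_const, ← hint]
  refine smul_le_smul_of_nonneg_left (mul_le_mul_of_nonneg_right ?_ hc)
    (inv_nonneg.2 measureReal_nonneg)
  exact setIntegral_abs_det_shear_le hcomp hsym ha heven ha_nonneg ha_le
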